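/- Let X be a real normed space, f : X → ℝ ∪ {−∞, +∞} a proper function, and x̄ ∈ dom f. Then S⁻(LĈ, f, x̄) ≠ ∅ if and only if S⁻max(LĈ, f, x̄) ≠ ∅, where S⁻max(LĈ, f, x̄) = S⁻max(LĈ, f) ∩ S⁻(LĈ, f, x̄); moreover, for every h ∈ S⁻(LĈ, f, x̄) there exists h̄ ∈ S⁻max(LĈ, f, x̄) with h ≤ h̄ pointwise. -/

import Mathlib

/-- A concave function lying above a function with slope bound `k` decreases with slope at
most `k`. -/
lemma ConcaveOn.sub_le_of_le_of_lipschitz {X : Type*} [NormedAddCommGroup X] [NormedSpace ℝ X]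
    {g h : X → ℝ} {k : ℝ} (hg : ConcaveOn ℝ Set.univ g) (hle : h ≤ g)
    (hk : ∀ x y, |h x - h y| ≤ k * ‖x - y‖) (x y : X) :
    g x - g y ≤ k * ‖x - y‖ := by
  have ray : ∀ t : ℝ, 0 < t → t * (g x - g y - k * ‖x - y‖) ≤ g y - h y := by
    intro t ht
    have ht1 : 0 < 1 + t := by linarith
    have hconc := hg.2 (Set.mem_univ (y + t • (y - x))) (Set.mem_univ x)
      (by positivity : 0 ≤ 1 / (1 + t)) (by positivity : 0 ≤ t / (1 + t)) (by field_simp)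
    have hpt : (1 / (1 + t)) • (y + t • (y - x)) + (t / (1 + t)) • x = y := by
      match_scalars <;> field_simp
      ring
    rw [hpt, smul_eq_mul, smul_eq_mul, div_mul_eq_mul_div, div_mul_eq_mul_div, ← add_div,
      div_le_iff₀ ht1] at hconc
    have hfar := hle (y + t • (y - x))
    have hlip := (abs_le.1 (hk (y + t • (y - x)) y)).1
    rw [add_sub_cancel_left, norm_smul, Real.norm_of_nonneg ht.le, norm_sub_rev] at hlip
    linarith
  by_contra! hlt
  have hd : 0 < g x - g y - k * ‖x - y‖ := by linarith
  have hgap : 0 ≤ g y - h y := sub_nonneg.2 (hle y)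
  have := ray ((g y - h y + 1) / (g x - g y - k * ‖x - y‖)) (by positivity)
  rw [div_mul_cancel₀ _ hd.ne'] at this
  linarith

/-- A concave function lying above a `k`-Lipschitz function is `k`-Lipschitz. -/
lemma ConcaveOn.abs_sub_le_of_le_of_lipschitz {X : Type*} [NormedAddCommGroup X]
    [NormedSpace ℝ X] {g h : X → ℝ} {k : ℝ} (hg : ConcaveOn ℝ Set.univ g) (hle : h ≤ g)
    (hk : ∀ x y, |h x - h y| ≤ k * ‖x - y‖) (x y : X) :
    |g x - g y| ≤ k * ‖x - y‖ := by
  have h₁ := hg.sub_le_of_le_of_lipschitz hle hk x y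
  have h₂ := hg.sub_le_of_le_of_lipschitz hle hk y x
  rw [norm_sub_rev] at h₂
  exact abs_le.2 ⟨by linarith, h₁⟩

/-- The pointwise supremum of a nonempty, pointwise bounded chain of concave functions is
concave. -/
lemma IsChain.concaveOn_iSup {X : Type*} [AddCommGroup X] [Module ℝ X] {c : Set (X → ℝ)}
    (hc : IsChain (· ≤ ·) c) (hne : c.Nonempty)
    (hbdd : ∀ x, BddAbove (Set.range fun g : c => g.1 x))
    (hconc : ∀ g ∈ c, ConcaveOn ℝ Set.univ g) :
    ConcaveOn ℝ Set.univ fun x => ⨆ g : c, g.1 x := by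
  have : Nonempty c := hne.to_subtype
  refine ⟨convex_univ, fun x _ y _ a b ha hb hab => ?_⟩
  refine le_of_forall_pos_le_add fun ε hε => ?_
  obtain ⟨g₁, h₁⟩ := exists_lt_of_lt_ciSup (sub_lt_self (⨆ g : c, g.1 x) hε)
  obtain ⟨g₂, h₂⟩ := exists_lt_of_lt_ciSup (sub_lt_self (⨆ g : c, g.1 y) hε)
  obtain ⟨g, hg, hg₁, hg₂⟩ := hc.directedOn g₁ g₁.2 g₂ g₂.2
  have hx : (⨆ g : c, g.1 x) ≤ g x + ε := by linarith [hg₁ x]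
  have hy : (⨆ g : c, g.1 y) ≤ g y + ε := by linarith [hg₂ y]
  have hcomb := (hconc g hg).2 (Set.mem_univ x) (Set.mem_univ y) ha hb hab
  have hsup := le_ciSup (hbdd (a • x + b • y)) ⟨g, hg⟩
  simp only [smul_eq_mul] at hcomb hsup ⊢
  calc a * (⨆ g : c, g.1 x) + b * (⨆ g : c, g.1 y)
      ≤ a * (g x + ε) + b * (g y + ε) := by gcongr
    _ = a * g x + b * g y + (a + b) * ε := by ring
    _ = a * g x + b * g y + ε := by rw [hab, one_mul]
    _ ≤ _ := by linarith

/-- For a proper `f : X → ℝ ∪ {−∞, +∞}` and a point `x₀ ∈ dom f`, the set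
`S⁻(LĈ, f, x₀)` of `LĈ`-minorants supporting `f` from below at `x₀` is nonempty iff
`S⁻max(LĈ, f, x₀) = S⁻max(LĈ, f) ∩ S⁻(LĈ, f, x₀)` is nonempty; moreover every
`h ∈ S⁻(LĈ, f, x₀)` is dominated pointwise by some `h̄ ∈ S⁻max(LĈ, f, x₀)`. -/
theorem statement7 {X : Type*} [NormedAddCommGroup X] [NormedSpace ℝ X]
    (f : X → EReal) (hproper : ∃ x, f x ≠ ⊤ ∧ f x ≠ ⊥)
    (x₀ : X) (hx₀ : f x₀ ≠ ⊤ ∧ f x₀ ≠ ⊥)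
    (S : Set (X → ℝ))
    (hS : S = {h : X → ℝ | (ConcaveOn ℝ Set.univ h ∧
        ∃ k : ℝ, 0 ≤ k ∧ ∀ x y : X, |h x - h y| ≤ k * ‖x - y‖) ∧
        ∀ x, (h x : EReal) ≤ f x})
    (M : Set (X → ℝ)) (hM : M = {h ∈ S | ∀ g ∈ S, h ≤ g → g = h})
    (Sx : Set (X → ℝ)) (hSx : Sx = {h ∈ S | (h x₀ : EReal) = f x₀}) :
    (Sx.Nonempty ↔ (M ∩ Sx).Nonempty) ∧
    (∀ h ∈ Sx, ∃ hb ∈ M ∩ Sx, h ≤ hb) := by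
  have dominated : ∀ h ∈ Sx, ∃ hb ∈ M ∩ Sx, h ≤ hb := by
    subst hM hSx hS
    rintro h ⟨⟨⟨hconc, k, hk0, hk⟩, hf⟩, hx⟩
    obtain ⟨m, hhm, hmax⟩ := zorn_le_nonempty₀
      {g : X → ℝ | ConcaveOn ℝ Set.univ g ∧ (∀ x, (g x : EReal) ≤ f x) ∧ h ≤ g} (by
        intro c hcs hc g₀ hg₀
        have : Nonempty c := ⟨⟨g₀, hg₀⟩⟩
        have hbound : ∀ x, ∀ g : c, g.1 x ≤ h x₀ + k * ‖x - x₀‖ := by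
          intro x g
          obtain ⟨hgc, hgf, hgh⟩ := hcs g.2
          have h₁ := hgc.sub_le_of_le_of_lipschitz hgh hk x x₀
          have h₂ : g.1 x₀ ≤ h x₀ := EReal.coe_le_coe_iff.1 (hx ▸ hgf x₀)
          linarith
        have hbdd : ∀ x, BddAbove (Set.range fun g : c => g.1 x) := fun x =>
          ⟨_, Set.forall_mem_range.2 (hbound x)⟩
        have hle : ∀ g ∈ c, g ≤ fun x => ⨆ g : c, g.1 x := fun g hg x =>
          le_ciSup (hbdd x) ⟨g, hg⟩
        refine ⟨fun x => ⨆ g : c, g.1 x, ⟨?_, fun x => ?_, ?_⟩, hle⟩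
        · exact hc.concaveOn_iSup ⟨g₀, hg₀⟩ hbdd fun g hg => (hcs hg).1
        · refine EReal.le_of_forall_lt_iff_le.1 fun z hz => ?_
          exact EReal.coe_le_coe_iff.2 (ciSup_le fun g =>
            EReal.coe_le_coe_iff.1 (((hcs g.2).2.1 x).trans hz.le))
        · exact (hcs hg₀).2.2.trans (hle g₀ hg₀))
      h ⟨hconc, hf, le_rfl⟩
    obtain ⟨hmc, hmf, -⟩ := hmax.prop
    have hlip := hmc.abs_sub_le_of_le_of_lipschitz hhm hk
    refine ⟨m, ⟨⟨⟨⟨hmc, k, hk0, hlip⟩, hmf⟩, fun g hg hmg => ?_⟩,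
      ⟨⟨hmc, k, hk0, hlip⟩, hmf⟩, ?_⟩, hhm⟩
    · exact (hmax.eq_of_le ⟨hg.1.1, hg.2, hhm.trans hmg⟩ hmg).symm
    · exact le_antisymm (hmf x₀) (hx ▸ EReal.coe_le_coe_iff.2 (hhm x₀))
  refine ⟨⟨fun ⟨h, hh⟩ => ?_, fun hne => hne.mono Set.inter_subset_right⟩, dominated⟩
  obtain ⟨hb, hmem, -⟩ := dominated h hh
  exact ⟨hb, hmem⟩
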